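/- For every positive integer q, limsup_{n→∞} (1/n) log₂ T(n, {q}) = limsup_{n→∞} (1/n) log₂ T(n, {1}); that is, the exponential growth rate of T(n, {q}) is independent of q. -/

import Mathlib

open Filter

/-- Two permutations of `[n]` are `G(D)`-different if at some position the
absolute difference of their values lies in `D`. `T n D` is the maximum
cardinality of a set of pairwise `G(D)`-different permutations of `[n]`. -/
noncomputable def T (n : ℕ) (D : Set ℕ) : ℕ :=
  sSup {k | ∃ S : Finset (Equiv.Perm (Fin n)), S.card = k ∧
    ∀ π ∈ S, ∀ σ ∈ S, π ≠ σ →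
      ∃ i : Fin n, ((π i : ℤ) - (σ i : ℤ)).natAbs ∈ D}

/-- A family of permutations of `[n]` is pairwise `G(D)`-different. -/
def PairwiseDifferent {n : ℕ} (D : Set ℕ) (S : Finset (Equiv.Perm (Fin n))) : Prop :=
  ∀ π ∈ S, ∀ σ ∈ S, π ≠ σ → ∃ i : Fin n, ((π i : ℤ) - (σ i : ℤ)).natAbs ∈ D

theorem T_bddAbove (n : ℕ) (D : Set ℕ) :
    BddAbove {k | ∃ S : Finset (Equiv.Perm (Fin n)), S.card = k ∧ PairwiseDifferent D S} := by
  refine ⟨Fintype.card (Equiv.Perm (Fin n)), ?_⟩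
  rintro _ ⟨S, rfl, -⟩
  exact S.card_le_univ

theorem PairwiseDifferent.card_le_T {n : ℕ} {D : Set ℕ} {S : Finset (Equiv.Perm (Fin n))}
    (hS : PairwiseDifferent D S) : S.card ≤ T n D :=
  le_csSup (T_bddAbove n D) ⟨S, rfl, hS⟩

theorem exists_card_eq_T (n : ℕ) (D : Set ℕ) :
    ∃ S : Finset (Equiv.Perm (Fin n)), S.card = T n D ∧ PairwiseDifferent D S :=
  Nat.sSup_mem (s := {k | ∃ S : Finset (Equiv.Perm (Fin n)), S.card = k ∧ PairwiseDifferent D S})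
    ⟨0, ∅, rfl, by simp [PairwiseDifferent]⟩ (T_bddAbove n D)

theorem T_pos (n : ℕ) (D : Set ℕ) : 0 < T n D := by
  have h : PairwiseDifferent D ({1} : Finset (Equiv.Perm (Fin n))) := by
    intro π hπ σ hσ hne
    rw [Finset.mem_singleton] at hπ hσ
    exact absurd (hπ.trans hσ.symm) hne
  exact h.card_le_T

theorem T_singleton_le_two_pow (n : ℕ) {q : ℕ} (hq : 1 ≤ q) : T n {q} ≤ 2 ^ n := by
  obtain ⟨S, hS, hd⟩ := exists_card_eq_T n {q}
  let color : Equiv.Perm (Fin n) → Fin n → Bool := fun π i => decide ((π i : ℕ) / q % 2 = 0)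
  have hinj : Set.InjOn color S := by
    intro π hπ σ hσ h
    by_contra hne
    obtain ⟨i, hi⟩ := hd π hπ σ hσ hne
    have hc : ((π i : ℕ) / q % 2 = 0) ↔ ((σ i : ℕ) / q % 2 = 0) := by
      simpa [color] using congrFun h i
    rw [Set.mem_singleton_iff] at hi
    obtain h1 | h1 : (π i : ℕ) = σ i + q ∨ (σ i : ℕ) = π i + q := by omega
    all_goals
      rw [h1, Nat.add_div_right _ hq] at hc
      omega
  rw [← hS, ← Finset.card_image_of_injOn hinj]
  exact (Finset.card_le_univ _).trans (by simp)

/-- Concatenating the residue classes modulo `q` embeds the `q`-distance graph on `[n]` into the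
path on `[n]`. -/
theorem exists_perm_natAbs_sub_eq_one (n : ℕ) {q : ℕ} (hq : 1 ≤ q) :
    ∃ e : Equiv.Perm (Fin n), ∀ a b : Fin n,
      ((a : ℤ) - b).natAbs = q → ((e a : ℤ) - e b).natAbs = 1 := by
  let key : Fin n → ℕ := fun a => (a : ℕ) / q + n * ((a : ℕ) % q)
  have hlt (a : Fin n) : (a : ℕ) / q < n := (Nat.div_le_self _ _).trans_lt a.2
  have hinj : Function.Injective key := by
    intro a b h
    have hn : 0 < n := a.pos
    have h1 : (a : ℕ) / q = (b : ℕ) / q := by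
      simpa [key, Nat.mod_eq_of_lt (hlt _)] using congrArg (· % n) h
    have h2 : (a : ℕ) % q = (b : ℕ) % q := by
      simpa [key, Nat.add_mul_div_left _ _ hn, Nat.div_eq_of_lt (hlt _)] using congrArg (· / n) h
    ext
    rw [← Nat.div_add_mod (a : ℕ) q, h1, h2, Nat.div_add_mod]
  let s := Finset.univ.image key
  have hs : s.card = n := by simp [s, Finset.card_image_of_injective _ hinj]
  let toKey : Fin n → s := fun a => ⟨key a, Finset.mem_image_of_mem _ (Finset.mem_univ a)⟩
  let r : Fin n → Fin n := fun a => (s.orderIsoOfFin hs).symm (toKey a)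
  have hr : Function.Injective r := fun a b h =>
    hinj (congrArg Subtype.val ((s.orderIsoOfFin hs).symm.injective h))
  have hsucc (a b : Fin n) (h : (b : ℕ) = a + q) : (r b : ℕ) = r a + 1 := by
    have hk : key b = key a + 1 := by
      simp only [key, h, Nat.add_div_right _ hq, Nat.add_mod_right]
      omega
    have hcov : toKey a ⋖ toKey b := by
      refine ⟨?_, fun c hac hcb => ?_⟩
      · rw [← Subtype.coe_lt_coe]
        simp only [toKey]
        omega
      · rw [← Subtype.coe_lt_coe] at hac hcb
        simp only [toKey] at hac hcb
        omega
    have h' : r a ⋖ r b := (apply_covBy_apply_iff (s.orderIsoOfFin hs).symm).2 hcov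
    exact (Nat.covBy_iff_add_one_eq.1 (Fin.covBy_iff.1 h')).symm
  refine ⟨Equiv.ofBijective r (Finite.injective_iff_bijective.1 hr), fun a b h => ?_⟩
  simp only [Equiv.ofBijective_apply]
  obtain h1 | h1 : (a : ℕ) = b + q ∨ (b : ℕ) = a + q := by omega
  all_goals
    have := hsucc _ _ h1
    omega

theorem T_singleton_le_T_one (n : ℕ) {q : ℕ} (hq : 1 ≤ q) : T n {q} ≤ T n {1} := by
  obtain ⟨S, hS, hd⟩ := exists_card_eq_T n {q}
  obtain ⟨e, he⟩ := exists_perm_natAbs_sub_eq_one n hq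
  have hd' : PairwiseDifferent {1} (S.map (mulLeftEmbedding e)) := by
    intro π hπ σ hσ hne
    obtain ⟨π, hπS, rfl⟩ := Finset.mem_map.1 hπ
    obtain ⟨σ, hσS, rfl⟩ := Finset.mem_map.1 hσ
    obtain ⟨i, hi⟩ := hd π hπS σ hσS (fun h => hne (by rw [h]))
    exact ⟨i, he _ _ hi⟩
  simpa [hS] using hd'.card_le_T

theorem T_one_pow_le (m q : ℕ) : T m {1} ^ q ≤ T (m * q) {q} := by
  obtain ⟨S, hS, hd⟩ := exists_card_eq_T m {1}
  let glue : (Fin q → Equiv.Perm (Fin m)) → Equiv.Perm (Fin (m * q)) := fun f =>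
    finProdFinEquiv.permCongr (Equiv.prodCongrLeft f)
  have hglue (f : Fin q → Equiv.Perm (Fin m)) (x : Fin m) (y : Fin q) :
      (glue f (finProdFinEquiv (x, y)) : ℕ) = y + q * f y x := by
    simp [glue, Equiv.permCongr_apply]
  have hinj : Function.Injective glue := by
    intro f g h
    ext y x
    have h1 := hglue f x y
    rw [h, hglue g x y] at h1
    exact (Nat.eq_of_mul_eq_mul_left y.pos (Nat.add_left_cancel h1)).symm
  have hd' : PairwiseDifferent {q} ((Fintype.piFinset fun _ : Fin q => S).image glue) := by
    intro π hπ σ hσ hne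
    obtain ⟨f, hf, rfl⟩ := Finset.mem_image.1 hπ
    obtain ⟨g, hg, rfl⟩ := Finset.mem_image.1 hσ
    obtain ⟨y, hy⟩ := Function.ne_iff.1 (fun h : f = g => hne (by rw [h]))
    obtain ⟨x, hx⟩ := hd _ (Fintype.mem_piFinset.1 hf y) _ (Fintype.mem_piFinset.1 hg y) hy
    refine ⟨finProdFinEquiv (x, y), ?_⟩
    rw [Set.mem_singleton_iff] at hx ⊢
    rw [hglue, hglue]
    push_cast
    rw [add_sub_add_left_eq_sub, ← mul_sub, Int.natAbs_mul, hx, Int.natAbs_natCast, mul_one]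
  simpa [Finset.card_image_of_injective _ hinj, hS] using hd'.card_le_T

theorem logb_T_div_nonneg (n : ℕ) (D : Set ℕ) : 0 ≤ Real.logb 2 (T n D : ℝ) / n :=
  div_nonneg (Real.logb_nonneg one_lt_two (by exact_mod_cast T_pos n D)) n.cast_nonneg

theorem logb_T_singleton_div_le_one (n : ℕ) {q : ℕ} (hq : 1 ≤ q) :
    Real.logb 2 (T n {q} : ℝ) / n ≤ 1 := by
  refine div_le_one_of_le₀ ?_ n.cast_nonneg
  rw [Real.logb_le_iff_le_rpow one_lt_two (by exact_mod_cast T_pos n {q}), Real.rpow_natCast]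
  exact_mod_cast T_singleton_le_two_pow n hq

theorem logb_T_singleton_div_le (n : ℕ) {q : ℕ} (hq : 1 ≤ q) :
    Real.logb 2 (T n {q} : ℝ) / n ≤ Real.logb 2 (T n {1} : ℝ) / n := by
  gcongr
  · exact one_lt_two
  · exact_mod_cast T_pos n {q}
  · exact T_singleton_le_T_one n hq

theorem logb_T_one_div_le (m : ℕ) {q : ℕ} (hq : 1 ≤ q) :
    Real.logb 2 (T m {1} : ℝ) / m ≤ Real.logb 2 (T (m * q) {q} : ℝ) / (m * q : ℕ) := by
  have hq' : (q : ℝ) ≠ 0 := by positivity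
  have hlog : q * Real.logb 2 (T m {1} : ℝ) ≤ Real.logb 2 (T (m * q) {q} : ℝ) := by
    rw [← Real.logb_pow]
    exact Real.logb_le_logb_of_le one_lt_two (by exact_mod_cast pow_pos (T_pos m {1}) q)
      (by exact_mod_cast T_one_pow_le m q)
  calc Real.logb 2 (T m {1} : ℝ) / m = q * Real.logb 2 (T m {1} : ℝ) / (m * q : ℕ) := by
        rw [Nat.cast_mul, mul_comm (m : ℝ), mul_div_mul_left _ _ hq']
    _ ≤ _ := by gcongr

/-- The exponential growth rate of `T(n, {q})` is independent of `q`. -/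
theorem growthRate_singleton_indep (q : ℕ) (hq : 1 ≤ q) :
    (Filter.atTop.limsup fun n : ℕ => Real.logb 2 (T n {q} : ℝ) / n) =
      Filter.atTop.limsup fun n : ℕ => Real.logb 2 (T n {1} : ℝ) / n := by
  have hbdd {p : ℕ} (hp : 1 ≤ p) (l : Filter ℕ) :
      l.IsBoundedUnder (· ≤ ·) fun n : ℕ => Real.logb 2 (T n {p} : ℝ) / n :=
    isBoundedUnder_of ⟨1, fun n => logb_T_singleton_div_le_one n hp⟩
  have hcobdd (p : ℕ) (l : Filter ℕ) [l.NeBot] :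
      l.IsCoboundedUnder (· ≤ ·) fun n : ℕ => Real.logb 2 (T n {p} : ℝ) / n :=
    (isBoundedUnder_of ⟨0, fun n => logb_T_div_nonneg n {p}⟩ :
      l.IsBoundedUnder (· ≥ ·) _).isCoboundedUnder_le
  apply le_antisymm
  · exact limsup_le_limsup (.of_forall fun n => logb_T_singleton_div_le n hq)
      (hcobdd q _) (hbdd le_rfl _)
  · have hmul : Tendsto (fun m : ℕ => m * q) atTop atTop := tendsto_id.atTop_mul_const' hq
    calc _ ≤ limsup (fun m : ℕ => Real.logb 2 (T (m * q) {q} : ℝ) / (m * q : ℕ)) atTop :=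
          limsup_le_limsup (.of_forall fun m => logb_T_one_div_le m hq)
            (hcobdd 1 _) (hbdd hq (map (fun m : ℕ => m * q) atTop))
      _ = limsup (fun n : ℕ => Real.logb 2 (T n {q} : ℝ) / n) (map (fun m : ℕ => m * q) atTop) :=
          rfl
      _ ≤ _ := limsup_le_limsup_of_le hmul (hcobdd q _) (hbdd hq _)
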